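/- arXiv:2009.06569 — 2 statements merged into one kernel-verified Lean document; each statement's English description precedes it below -/
import Mathlib

section
/- (Chuckrow) Let Γ be a finitely generated group that does not contain an infinite normal nilpotent subgroup. Then the set of maps f : Γ → GL(n,ℝ) that are group homomorphisms, are injective, and have discrete image is a closed subset of the space of all maps Γ → GL(n,ℝ) equipped with the topology of pointwise convergence (product topology). -/
namespace Chuckrow

open scoped commutatorElement

/-- derived series of a subgroup, in the ambient group -/
def dser {G : Type*} [Group G] (M : Subgroup G) : ℕ → Subgroup G
  | 0 => M
  | k + 1 => ⁅dser M k, dser M k⁆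

theorem dser_succ' {G : Type*} [Group G] (M : Subgroup G) (k : ℕ) :
    dser M (k + 1) = dser ⁅M, M⁆ k := by
  induction k with
  | zero => rfl
  | succ k ih => rw [dser, ih, ← dser]

theorem dser_mono {G : Type*} [Group G] {M N : Subgroup G} (h : M ≤ N) (k : ℕ) :
    dser M k ≤ dser N k := by
  induction k with
  | zero => exact h
  | succ k ih => exact Subgroup.commutator_mono ih ih

theorem dser_map {G : Type*} [Group G] (M : Subgroup G) (k : ℕ) :
    (derivedSeries M k).map M.subtype = dser M k := by
  induction k with
  | zero => simp [dser, ← MonoidHom.range_eq_map]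
  | succ k ih => rw [derivedSeries_succ, Subgroup.map_commutator, ih, dser]

theorem dser_local {G : Type*} [Group G] (M : Subgroup G) (k : ℕ) :
    ∀ x ∈ dser M k, ∃ T : Finset G, (T : Set G) ⊆ M ∧ x ∈ dser (Subgroup.closure (T : Set G)) k := by
  classical
  have union : ∀ (k : ℕ) (T U : Finset G),
      dser (Subgroup.closure (T : Set G)) k ≤ dser (Subgroup.closure ((T ∪ U : Finset G) : Set G)) k ∧
      dser (Subgroup.closure (U : Set G)) k ≤ dser (Subgroup.closure ((T ∪ U : Finset G) : Set G)) k := by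
    intro k T U
    constructor <;> refine dser_mono (Subgroup.closure_mono ?_) k <;> simp
  induction k with
  | zero =>
    intro x hx
    refine ⟨{x}, by simpa [dser] using hx, ?_⟩
    exact Subgroup.subset_closure (by simp)
  | succ k ih =>
    intro x hx
    rw [dser, Subgroup.commutator_def] at hx
    induction hx using Subgroup.closure_induction with
    | mem x hx =>
      obtain ⟨a, ha, b, hb, rfl⟩ := hx
      obtain ⟨T, hT, hTa⟩ := ih a ha
      obtain ⟨U, hU, hUb⟩ := ih b hb
      refine ⟨T ∪ U, by simp [hT, hU], ?_⟩
      exact Subgroup.commutator_mem_commutator ((union k T U).1 hTa) ((union k T U).2 hUb)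
    | one => exact ⟨∅, by simp, one_mem _⟩
    | mul x y _ _ hx hy =>
      obtain ⟨T, hT, hTa⟩ := hx
      obtain ⟨U, hU, hUb⟩ := hy
      refine ⟨T ∪ U, by simp [hT, hU], ?_⟩
      exact mul_mem ((union (k+1) T U).1 hTa) ((union (k+1) T U).2 hUb)
    | inv x _ hx =>
      obtain ⟨T, hT, hTa⟩ := hx
      exact ⟨T, hT, inv_mem hTa⟩

theorem comm_mem_of_closure {G : Type*} [Group G] {S : Set G} (hS : Subgroup.closure S = ⊤)
    (Z : Subgroup G) [hZ : Z.Normal] (t : G) (h : ∀ s ∈ S, ⁅t, s⁆ ∈ Z) (y : G) : ⁅t, y⁆ ∈ Z := by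
  have hy : y ∈ Subgroup.closure S := by rw [hS]; trivial
  induction hy using Subgroup.closure_induction with
  | mem x hx => exact h x hx
  | one => simp
  | mul a b _ _ ha hb =>
    have : ⁅t, a * b⁆ = ⁅t, a⁆ * (a * ⁅t, b⁆ * a⁻¹) := by simp only [commutatorElement_def]; group
    rw [this]
    exact mul_mem ha (hZ.conj_mem _ hb a)
  | inv a _ ha =>
    have : ⁅t, a⁻¹⁆ = a⁻¹ * ⁅t, a⁆⁻¹ * a⁻¹⁻¹ := by simp only [commutatorElement_def]; group
    rw [this]
    exact hZ.conj_mem _ (inv_mem ha) _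

theorem nilpotent_of_comm {G : Type*} [Group G] {S : Set G} (hS : Subgroup.closure S = ⊤)
    (C : ℕ → Set G) (h0 : S ⊆ C 0) (hC : ∀ i, ∀ t ∈ C i, ∀ s ∈ S, ⁅t, s⁆ ∈ C (i + 1))
    (m : ℕ) (hm : ∀ t ∈ C m, t = 1) : Group.IsNilpotent G := by
  have key : ∀ j i, i + j = m → C i ⊆ Subgroup.upperCentralSeries G j := by
    intro j
    induction j with
    | zero =>
      intro i hi t ht
      simp only [add_zero] at hi
      subst hi
      simp [hm t ht]
    | succ j ih =>
      intro i hi t ht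
      refine Subgroup.mem_upperCentralSeries_succ_iff.2 ?_
      refine comm_mem_of_closure hS _ t fun s hs => ih (i+1) (by omega) (hC i t ht s hs)
  refine ⟨m, ?_⟩
  rw [eq_top_iff, ← hS, Subgroup.closure_le]
  exact h0.trans (key m 0 (by simp))

theorem finite_of_dser {G : Type*} [Group G]
    (hnil : ¬ ∃ N : Subgroup G, N.Normal ∧ Group.IsNilpotent N ∧ (N : Set G).Infinite)
    (k : ℕ) : ∀ (M : Subgroup G), M.Normal → dser M k = ⊥ → (M : Set G).Finite := by
  induction k with
  | zero =>
    intro M _ h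
    have : M = ⊥ := h
    simp [this]
  | succ k ih =>
    intro M hM h
    rw [dser_succ'] at h
    have hfin := ih ⁅M, M⁆ inferInstance h
    have : Finite (⁅M, M⁆ : Subgroup G) := hfin
    let φ : G →* MulAut (⁅M, M⁆ : Subgroup G) := MulAut.conjNormal
    have hφ : ∀ g, g ∈ φ.ker → ∀ x ∈ ⁅M, M⁆, ⁅x, g⁆ = 1 := by
      intro g hg x hx
      have h1 : φ g = 1 := hg
      have h2 := MulAut.conjNormal_apply g (⟨x, hx⟩ : (⁅M, M⁆ : Subgroup G))
      have h3 : MulAut.conjNormal g = (1 : MulAut (⁅M, M⁆ : Subgroup G)) := h1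
      rw [h3] at h2
      simp only [MulAut.one_apply] at h2
      rw [commutatorElement_eq_one_iff_mul_comm]
      exact (eq_mul_inv_iff_mul_eq.1 h2)
    have hCn : (φ.ker ⊓ M).Normal := inferInstance
    have hnilp : Group.IsNilpotent (φ.ker ⊓ M : Subgroup G) := by
      rw [Subgroup.isNilpotent_iff_lowerCentralSeries]
      refine ⟨2, ?_⟩
      rw [eq_bot_iff, Subgroup.lowerCentralSeries_succ, Subgroup.commutator_le]
      intro a ha b hb
      have : a ∈ ⁅M, M⁆ := Subgroup.commutator_mono inf_le_right inf_le_right ha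
      exact hφ b hb.1 a this
    have hCfin : ((φ.ker ⊓ M : Subgroup G) : Set G).Finite := by
      by_contra hinf
      exact hnil ⟨_, hCn, hnilp, hinf⟩
    have : Finite M := by
      rw [MonoidHom.finite_iff_finite_ker_range (φ.comp M.subtype)]
      refine ⟨?_, inferInstance⟩
      have : Finite (φ.ker ⊓ M : Subgroup G) := hCfin
      refine Finite.of_injective
        (fun x : (φ.comp M.subtype).ker => (⟨x.1.1, x.2, x.1.2⟩ : (φ.ker ⊓ M : Subgroup G))) ?_
      intro x y hxy
      exact Subtype.ext (Subtype.ext (congrArg Subtype.val hxy :))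
    exact this

theorem lambda_eq_one {V : Type*} [AddCommGroup V] [Module ℂ V] [FiniteDimensional ℂ V]
    [Nontrivial V] (g z : Module.End ℂ V) (hz : Function.Injective z) (c : ℂ)
    (h : ∀ v, z (g v) = c • g (z v))
    (hg : ∀ μ : ℂ, μ.re ≤ 0 → ∀ v, g v = μ • v → v = 0) : c = 1 := by
  classical
  have hc : c ≠ 0 := by
    rintro rfl
    obtain ⟨v, hv⟩ := exists_ne (0 : V)
    apply hv
    apply hg 0 (by simp)
    apply hz
    simp [h]
  have hfin : {μ : ℂ | g.HasEigenvalue μ}.Finite := Module.End.finite_hasEigenvalue g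
  obtain ⟨μ₀, hμ₀⟩ := Module.End.exists_eigenvalue g
  set s : Finset ℂ := hfin.toFinset with hs
  have hmem : ∀ μ, μ ∈ s ↔ g.HasEigenvalue μ := by intro μ; simp [hs]
  have hpos : ∀ μ ∈ s, 0 < μ.re := by
    intro μ hμ
    by_contra hle
    obtain ⟨v, hv⟩ := ((hmem μ).1 hμ).exists_hasEigenvector
    exact hv.2 (hg μ (not_lt.1 hle) v hv.apply_eq_smul)
  have hsub : s.image (fun μ => c⁻¹ * μ) ⊆ s := by
    intro ν hν
    obtain ⟨μ, hμ, rfl⟩ := Finset.mem_image.1 hν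
    obtain ⟨v, hv⟩ := ((hmem μ).1 hμ).exists_hasEigenvector
    rw [hmem]
    refine Module.End.hasEigenvalue_of_hasEigenvector (x := z v) ⟨?_, ?_⟩
    · rw [Module.End.mem_eigenspace_iff]
      have := h v
      rw [hv.apply_eq_smul, map_smul] at this
      rw [mul_smul, this, smul_smul, inv_mul_cancel₀ hc, one_smul]
    · intro h0
      exact hv.2 (hz (by simpa using h0))
  have hinj : Function.Injective (fun μ : ℂ => c⁻¹ * μ) := mul_right_injective₀ (inv_ne_zero hc)
  have heq : s.image (fun μ => c⁻¹ * μ) = s :=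
    Finset.eq_of_subset_of_card_le hsub (by rw [Finset.card_image_of_injective _ hinj])
  have hsum : ∑ μ ∈ s, μ = c⁻¹ * ∑ μ ∈ s, μ := by
    conv_lhs => rw [← heq]
    rw [Finset.sum_image (fun _ _ _ _ hxy => hinj hxy), Finset.mul_sum]
  have hne : ∑ μ ∈ s, μ ≠ 0 := by
    intro h0
    have h1 : (∑ μ ∈ s, μ).re = 0 := by rw [h0]; simp
    rw [Complex.re_sum] at h1
    have := Finset.sum_pos hpos ⟨μ₀, (hmem _).2 hμ₀⟩
    linarith
  have h1 : c⁻¹ = 1 := by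
    have : 1 * ∑ μ ∈ s, μ = c⁻¹ * ∑ μ ∈ s, μ := by rw [one_mul]; exact hsum
    exact (mul_right_cancel₀ hne this).symm
  exact inv_eq_one.1 h1

section core

set_option linter.unusedSectionVars false

variable {A : Type*} [Ring A] [Algebra ℂ A] {H : Type*} [Group H] {S : Set H}

theorem commute_all {V : Type*} [AddCommGroup V] [Module ℂ V] [Module A V] [IsScalarTower ℂ A V]
    (hS : Subgroup.closure S = ⊤) (w : H →* A) (hA : Algebra.adjoin ℂ (Set.range w) = ⊤)
    (z : Module.End ℂ V) (hz : ∀ s ∈ S, ∀ v : V, z (w s • v) = w s • z v) (a : A) (v : V) :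
    z (a • v) = a • z v := by
  have h1 : ∀ h : H, ∀ v : V, z (w h • v) = w h • z v := by
    intro h
    have hh : h ∈ Subgroup.closure S := by rw [hS]; trivial
    induction hh using Subgroup.closure_induction with
    | mem x hx => exact hz x hx
    | one => simp
    | mul x y _ _ hx hy => intro v; rw [map_mul, mul_smul, mul_smul, hx, hy]
    | inv x _ hx =>
      intro v
      have e : w x⁻¹ * w x = 1 := by rw [← map_mul]; simp
      have e' : w x * w x⁻¹ = 1 := by rw [← map_mul]; simp
      have := hx (w x⁻¹ • v)
      rw [smul_smul, e', one_smul] at this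
      rw [this, smul_smul, e, one_smul]
  have ha : a ∈ Algebra.adjoin ℂ (Set.range w) := by rw [hA]; trivial
  induction ha using Algebra.adjoin_induction generalizing v with
  | mem x hx => obtain ⟨h, rfl⟩ := hx; exact h1 h v
  | algebraMap r => rw [algebraMap_smul, algebraMap_smul, map_smul]
  | add x y _ _ hx hy => rw [add_smul, add_smul, map_add, hx, hy]
  | mul x y _ _ hx hy => rw [mul_smul, mul_smul, hx, hy]

theorem scalar_of_simple {V : Type*} [AddCommGroup V] [Module ℂ V] [Module A V]
    [IsScalarTower ℂ A V] [FiniteDimensional ℂ V] [Nontrivial V] [Group.IsNilpotent H]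
    (hS : Subgroup.closure S = ⊤) (w : H →* A) (hA : Algebra.adjoin ℂ (Set.range w) = ⊤)
    (hgood : ∀ s ∈ S, ∀ μ : ℂ, μ.re ≤ 0 → ∀ v : V, w s • v = μ • v → v = 0)
    (hsimple : ∀ E : Submodule A V, E = ⊥ ∨ E = ⊤) (a : A) : ∃ c : ℂ, ∀ v : V, a • v = c • v := by
  have key : ∀ j, ∀ z ∈ Subgroup.upperCentralSeries H j, ∃ c : ℂ, ∀ v : V, w z • v = c • v := by
    intro j
    induction j with
    | zero =>
      intro z hz
      have : z = 1 := by simpa using hz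
      exact ⟨1, by simp [this]⟩
    | succ j ih =>
      intro z hz
      let Z : Module.End ℂ V := Algebra.lsmul ℂ ℂ V (w z)
      have hZ : ∀ v, Z v = w z • v := fun v => rfl
      have hinj : Function.Injective Z := by
        intro v v' hv
        rw [hZ, hZ] at hv
        have := congrArg (fun t => w z⁻¹ • t) hv
        simpa only [smul_smul, ← map_mul, inv_mul_cancel, map_one, one_smul] using this
      have hcomm : ∀ (a : A) (v : V), Z (a • v) = a • Z v := by
        refine commute_all hS w hA Z ?_
        intro s hs v
        obtain ⟨c, hc⟩ := ih ⁅z, s⁆ (Subgroup.mem_upperCentralSeries_succ_iff.1 hz s)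
        have hrel : ∀ v : V, w z • (w s • v) = c • (w s • (w z • v)) := by
          intro v
          rw [← hc, smul_smul, smul_smul, smul_smul, ← map_mul, ← map_mul, ← map_mul]
          congr 2
          simp only [commutatorElement_def]; group
        have hc1 : c = 1 := lambda_eq_one (Algebra.lsmul ℂ ℂ V (w s)) Z hinj c hrel (hgood s hs)
        rw [hZ, hZ, hrel, hc1, one_smul]
      obtain ⟨c, hc⟩ := Module.End.exists_eigenvalue Z
      obtain ⟨v, hv⟩ := hc.exists_hasEigenvector
      let E : Submodule A V :=
        { carrier := {v | Z v = c • v}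
          add_mem' := by intro x y hx hy; simp only [Set.mem_ofPred_eq] at *; rw [map_add, hx, hy, smul_add]
          zero_mem' := by simp
          smul_mem' := by
            intro a x hx
            simp only [Set.mem_ofPred_eq] at *
            rw [hcomm, hx, smul_comm] }
      have hE : E = ⊤ := by
        refine (hsimple E).resolve_left ?_
        intro h0
        have : v ∈ E := hv.apply_eq_smul
        rw [h0] at this
        exact hv.2 (by simpa using this)
      refine ⟨c, fun x => ?_⟩
      have : x ∈ E := by rw [hE]; trivial
      exact this
  obtain ⟨m, hm⟩ := Group.IsNilpotent.nilpotent H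
  have ha : a ∈ Algebra.adjoin ℂ (Set.range w) := by rw [hA]; trivial
  induction ha using Algebra.adjoin_induction with
  | mem x hx => obtain ⟨h, rfl⟩ := hx; exact key m h (by rw [hm]; trivial)
  | algebraMap r => exact ⟨r, fun v => by rw [algebraMap_smul]⟩
  | add x y _ _ hx hy =>
    obtain ⟨c, hc⟩ := hx
    obtain ⟨d, hd⟩ := hy
    exact ⟨c + d, fun v => by rw [add_smul, hc, hd, add_smul]⟩
  | mul x y _ _ hx hy =>
    obtain ⟨c, hc⟩ := hx
    obtain ⟨d, hd⟩ := hy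
    exact ⟨c * d, fun v => by rw [mul_smul, hd, hc, mul_smul]⟩

/-- the subgroup acting trivially -/
def actKer {N : Type*} [Group N] (u : N →* A) (V : Type*) [AddCommGroup V] [Module A V] :
    Subgroup N where
  carrier := {x | ∀ v : V, u x • v = v}
  mul_mem' := by
    intro x y hx hy v
    rw [map_mul, mul_smul, hy, hx]
  one_mem' := by simp
  inv_mem' := by
    intro x hx v
    have := hx (u x⁻¹ • v)
    rw [smul_smul, ← map_mul, mul_inv_cancel, map_one, one_smul] at this
    exact this.symm

theorem comm_mem_actKer {N : Type*} [Group N] (u : N →* A) (V : Type*) [AddCommGroup V]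
    [Module A V] (x y : N) (h : ∀ v : V, u x • (u y • v) = u y • (u x • v)) :
    ⁅x, y⁆ ∈ actKer u V := by
  intro v
  have h1 := h (u (x⁻¹ * y⁻¹) • v)
  have e1 : u ⁅x, y⁆ • v = u x • (u y • (u (x⁻¹ * y⁻¹) • v)) := by
    simp only [smul_smul, ← map_mul, commutatorElement_def]
    congr 2; group
  rw [e1, h1]
  simp only [smul_smul, ← map_mul]
  rw [show y * (x * (x⁻¹ * y⁻¹)) = 1 by group]
  simp

theorem core {N : Type*} [Group N] [Group.IsNilpotent H]
    (hS : Subgroup.closure S = ⊤) (w : H →* A) (hA : Algebra.adjoin ℂ (Set.range w) = ⊤)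
    (u : N →* A) (d : ℕ) : ∀ (V : Type) [AddCommGroup V] [Module ℂ V] [Module A V]
      [IsScalarTower ℂ A V] [FiniteDimensional ℂ V], Module.finrank ℂ V ≤ d →
      (∀ s ∈ S, ∀ μ : ℂ, μ.re ≤ 0 → ∀ v : V, w s • v = μ • v → v = 0) →
      derivedSeries N d ≤ actKer u V := by
  induction d with
  | zero =>
    intro V _ _ _ _ _ hd _ x _ v
    have : Subsingleton V := Module.finrank_zero_iff.1 (Nat.le_zero.1 hd)
    exact Subsingleton.elim _ _
  | succ d ih =>
    intro V _ _ _ _ _ hd hgood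
    rw [derivedSeries_succ, Subgroup.commutator_le]
    rcases subsingleton_or_nontrivial V with hV | hV
    · intro x _ y _ v
      exact Subsingleton.elim _ _
    by_cases hsimple : ∀ E : Submodule A V, E = ⊥ ∨ E = ⊤
    · intro x _ y _
      apply comm_mem_actKer
      intro v
      obtain ⟨c, hc⟩ := scalar_of_simple hS w hA hgood hsimple (u x)
      obtain ⟨c', hc'⟩ := scalar_of_simple hS w hA hgood hsimple (u y)
      simp only [hc, hc', smul_comm c c']
    · push Not at hsimple
      obtain ⟨E, hE0, hE1⟩ := hsimple
      let E' : Submodule ℂ V := E.restrictScalars ℂ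
      have hE'0 : E' ≠ ⊥ := by simpa [E'] using hE0
      have hE'1 : E' ≠ ⊤ := by simpa [E'] using hE1
      have f1 : Module.finrank ℂ E' < Module.finrank ℂ V := Submodule.finrank_lt hE'1
      have f2 : Module.finrank ℂ (V ⧸ E') < Module.finrank ℂ V := by
        have a1 := Submodule.finrank_quotient_add_finrank E'
        have a2 := Submodule.one_le_finrank_iff.2 hE'0
        omega
      have : FiniteDimensional ℂ E := inferInstanceAs (FiniteDimensional ℂ E')
      have : FiniteDimensional ℂ (V ⧸ E) := inferInstanceAs (FiniteDimensional ℂ (V ⧸ E'))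
      have g1 : Module.finrank ℂ E ≤ d := by
        have : Module.finrank ℂ E = Module.finrank ℂ E' := rfl
        omega
      have g2 : Module.finrank ℂ (V ⧸ E) ≤ d := by
        have : Module.finrank ℂ (V ⧸ E) = Module.finrank ℂ (V ⧸ E') := rfl
        omega
      have k1 := ih E g1 (by
        intro s hs μ hμ v hv
        apply Subtype.ext
        exact hgood s hs μ hμ v.1 (congrArg Subtype.val hv))
      have k2 := ih (V ⧸ E) g2 (by
        intro s hs μ hμ v hv
        let T : Module.End ℂ V := Algebra.lsmul ℂ ℂ V (w s) - μ • LinearMap.id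
        have hT : ∀ x, T x = w s • x - μ • x := fun x => rfl
        have hTinj : Function.Injective T := by
          rw [injective_iff_map_eq_zero]
          intro x hx
          exact hgood s hs μ hμ x (sub_eq_zero.1 hx)
        let T' : Module.End ℂ (V ⧸ E) := Algebra.lsmul ℂ ℂ (V ⧸ E) (w s) - μ • LinearMap.id
        have hT' : ∀ x, T' x = w s • x - μ • x := fun x => rfl
        have hTsurj := LinearMap.injective_iff_surjective.1 hTinj
        have hT'surj : Function.Surjective T' := by
          intro y
          obtain ⟨y, rfl⟩ := Submodule.Quotient.mk_surjective E y
          obtain ⟨x, rfl⟩ := hTsurj y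
          exact ⟨Submodule.Quotient.mk x, rfl⟩
        have hT'inj := LinearMap.injective_iff_surjective.2 hT'surj
        apply hT'inj
        rw [hT', hv, sub_self, map_zero])
      have q1 : ∀ x ∈ derivedSeries N d, ∀ e ∈ E, u x • e = e := by
        intro x hx e he
        exact congrArg Subtype.val (k1 hx ⟨e, he⟩)
      have q2 : ∀ x ∈ derivedSeries N d, ∀ v : V, u x • v - v ∈ E := by
        intro x hx v
        rw [← Submodule.Quotient.eq]
        exact k2 hx (Submodule.Quotient.mk v)
      intro x hx y hy
      apply comm_mem_actKer
      intro v
      have e1 : u x • (u y • v) = u x • v + (u y • v - v) := by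
        conv_rhs => rw [← q1 x hx _ (q2 y hy v)]
        rw [smul_sub]; abel
      have e2 : u y • (u x • v) = u y • v + (u x • v - v) := by
        conv_rhs => rw [← q1 y hy _ (q2 x hx v)]
        rw [smul_sub]; abel
      rw [e1, e2]; abel

end core

section analytic

open scoped Matrix.Norms.Operator Topology
open Matrix

variable {n : ℕ}

/-- neighbourhoods of the identity -/
def near (n : ℕ) (ε : ℝ) : Set (GL (Fin n) ℝ) :=
  {g | ‖(g : Matrix (Fin n) (Fin n) ℝ) - 1‖ < ε ∧ ‖((g⁻¹ : GL (Fin n) ℝ) : Matrix (Fin n) (Fin n) ℝ) - 1‖ < ε}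

theorem near_open (ε : ℝ) : IsOpen (near n ε) := by
  have h1 : Continuous fun g : GL (Fin n) ℝ => (g : Matrix (Fin n) (Fin n) ℝ) := Units.continuous_val
  have h2 : Continuous fun g : GL (Fin n) ℝ => ((g⁻¹ : GL (Fin n) ℝ) : Matrix (Fin n) (Fin n) ℝ) :=
    h1.comp continuous_inv
  exact (isOpen_lt (h1.sub continuous_const).norm continuous_const).inter
    (isOpen_lt (h2.sub continuous_const).norm continuous_const)

theorem one_mem_near {ε : ℝ} (hε : 0 < ε) : (1 : GL (Fin n) ℝ) ∈ near n ε := by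
  simp [near, hε]

theorem near_mono {ε δ : ℝ} (h : ε ≤ δ) : near n ε ⊆ near n δ :=
  fun _ hg => ⟨hg.1.trans_le h, hg.2.trans_le h⟩

theorem near_inv {ε : ℝ} {g : GL (Fin n) ℝ} (h : g ∈ near n ε) : g⁻¹ ∈ near n ε :=
  ⟨h.2, by rw [inv_inv]; exact h.1⟩

theorem exists_near {W : Set (GL (Fin n) ℝ)} (hW : W ∈ 𝓝 1) : ∃ δ > 0, near n δ ⊆ W := by
  have h := (Units.isOpenEmbedding_val (R := Matrix (Fin n) (Fin n) ℝ)).isInducing.nhds_eq_comap 1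
  have hW' := Filter.mem_comap.1 (h.symm.le hW)
  obtain ⟨t, ht, htW⟩ := hW'
  obtain ⟨δ, hδ, hb⟩ := Metric.mem_nhds_iff.1 ht
  refine ⟨δ, hδ, fun g hg => htW (hb ?_)⟩
  rw [Metric.mem_ball, dist_eq_norm]
  exact hg.1

theorem norm_one_le' : ‖(1 : Matrix (Fin n) (Fin n) ℝ)‖ ≤ 1 := by
  rw [← Matrix.diagonal_one, Matrix.linfty_opNorm_diagonal]
  refine (pi_norm_le_iff_of_nonneg zero_le_one).2 fun i => by simp

theorem norm_comm {ε δ : ℝ} {s t : GL (Fin n) ℝ} (hε : ε ≤ 1 / 16) (hδ : δ ≤ 1 / 16)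
    (hs : s ∈ near n ε) (ht : t ∈ near n δ) :
    ‖((⁅t, s⁆ : GL (Fin n) ℝ) : Matrix (Fin n) (Fin n) ℝ) - 1‖ < ε * δ * 8 := by
  have e : ((⁅t, s⁆ : GL (Fin n) ℝ) : Matrix (Fin n) (Fin n) ℝ) - 1 =
      (((t : Matrix (Fin n) (Fin n) ℝ) - 1) * ((s : Matrix (Fin n) (Fin n) ℝ) - 1)
        - ((s : Matrix (Fin n) (Fin n) ℝ) - 1) * ((t : Matrix (Fin n) (Fin n) ℝ) - 1))
      * (((t⁻¹ : GL (Fin n) ℝ) : Matrix (Fin n) (Fin n) ℝ) * ((s⁻¹ : GL (Fin n) ℝ) : Matrix (Fin n) (Fin n) ℝ)) := by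
    have e1 : (s : Matrix (Fin n) (Fin n) ℝ) * (t : Matrix (Fin n) (Fin n) ℝ) *
      (((t⁻¹ : GL (Fin n) ℝ) : Matrix (Fin n) (Fin n) ℝ) * ((s⁻¹ : GL (Fin n) ℝ) : Matrix (Fin n) (Fin n) ℝ)) = 1 := by
      simp only [← Units.val_mul]
      rw [show s * t * (t⁻¹ * s⁻¹) = 1 by group]; simp
    have e2 : ((⁅t, s⁆ : GL (Fin n) ℝ) : Matrix (Fin n) (Fin n) ℝ) =
      (t : Matrix (Fin n) (Fin n) ℝ) * (s : Matrix (Fin n) (Fin n) ℝ) *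
      (((t⁻¹ : GL (Fin n) ℝ) : Matrix (Fin n) (Fin n) ℝ) * ((s⁻¹ : GL (Fin n) ℝ) : Matrix (Fin n) (Fin n) ℝ)) := by
      simp only [← Units.val_mul, commutatorElement_def, mul_assoc]
    rw [e2]
    nth_rewrite 1 [← e1]
    noncomm_ring
  have inv_le : ∀ {η : ℝ} {g : GL (Fin n) ℝ}, η ≤ 1 / 16 → g ∈ near n η →
      ‖((g⁻¹ : GL (Fin n) ℝ) : Matrix (Fin n) (Fin n) ℝ)‖ ≤ 2 := by
    intro η g hη hg
    have h1 := hg.2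
    have h2 : ‖((g⁻¹ : GL (Fin n) ℝ) : Matrix (Fin n) (Fin n) ℝ)‖ ≤
      ‖((g⁻¹ : GL (Fin n) ℝ) : Matrix (Fin n) (Fin n) ℝ) - 1‖ + ‖(1 : Matrix (Fin n) (Fin n) ℝ)‖ := by
      simpa using norm_add_le (((g⁻¹ : GL (Fin n) ℝ) : Matrix (Fin n) (Fin n) ℝ) - 1) 1
    have := norm_one_le' (n := n)
    linarith
  have hsi := inv_le hε hs
  have hti := inv_le hδ ht
  have hs1 := hs.1
  have ht1 := ht.1
  rw [e]
  set a := (t : Matrix (Fin n) (Fin n) ℝ) - 1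
  set b := (s : Matrix (Fin n) (Fin n) ℝ) - 1
  have hab : ‖a * b - b * a‖ ≤ 2 * (‖a‖ * ‖b‖) := by
    calc _ ≤ ‖a * b‖ + ‖b * a‖ := norm_sub_le _ _
      _ ≤ ‖a‖ * ‖b‖ + ‖b‖ * ‖a‖ := add_le_add (norm_mul_le _ _) (norm_mul_le _ _)
      _ = _ := by ring
  have hlt : ‖a‖ * ‖b‖ < ε * δ := by
    have := mul_lt_mul'' ht1 hs1 (norm_nonneg _) (norm_nonneg _)
    linarith
  refine (norm_mul_le _ _).trans_lt ?_
  have hinv := (norm_mul_le ((t⁻¹ : GL (Fin n) ℝ) : Matrix (Fin n) (Fin n) ℝ) ((s⁻¹ : GL (Fin n) ℝ) : Matrix (Fin n) (Fin n) ℝ)).trans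
    (mul_le_mul hti hsi (norm_nonneg _) (by norm_num))
  calc _ ≤ (2 * (‖a‖ * ‖b‖)) * (2 * 2) := mul_le_mul hab hinv (norm_nonneg _) (by positivity)
    _ < _ := by linarith

theorem near_comm {δ : ℝ} {s t : GL (Fin n) ℝ} (hδ : δ ≤ 1 / 16)
    (hs : s ∈ near n (1 / 16)) (ht : t ∈ near n δ) : ⁅t, s⁆ ∈ near n (δ / 2) := by
  constructor
  · have := norm_comm le_rfl hδ hs ht
    linarith
  · rw [commutatorElement_inv]
    have := norm_comm hδ le_rfl ht hs
    linarith

theorem zassenhaus {Γ : Type*} [Group Γ] (φ : Γ →* GL (Fin n) ℝ) (hinj : Function.Injective φ)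
    (hdisc : DiscreteTopology (Set.range φ)) (S : Set Γ) (hS : ∀ s ∈ S, φ s ∈ near n (1 / 16)) :
    Group.IsNilpotent (Subgroup.closure S) := by
  have h1 : (1 : GL (Fin n) ℝ) ∈ Set.range φ := ⟨1, map_one φ⟩
  have h2 : ∃ W ∈ 𝓝 (1 : GL (Fin n) ℝ), ∀ x, φ x ∈ W → φ x = 1 := by
    have h3 : ({⟨1, h1⟩} : Set (Set.range φ)) ∈ 𝓝 (⟨1, h1⟩ : Set.range φ) :=
      (isOpen_discrete _).mem_nhds rfl
    obtain ⟨W, hW, hsub⟩ := mem_nhds_subtype _ _ _ |>.1 h3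
    refine ⟨W, hW, fun x hx => ?_⟩
    have : (⟨φ x, x, rfl⟩ : Set.range φ) ∈ ({⟨1, h1⟩} : Set (Set.range φ)) := hsub hx
    exact congrArg Subtype.val this
  obtain ⟨W, hW, hW1⟩ := h2
  obtain ⟨δ, hδ, hnear⟩ := exists_near hW
  obtain ⟨m, hm⟩ := exists_pow_lt_of_lt_one hδ (by norm_num : (1 / 2 : ℝ) < 1)
  refine nilpotent_of_comm (S := (Subtype.val : Subgroup.closure S → Γ) ⁻¹' S)
    Subgroup.closure_closure_coe_preimage
    (fun i => {x | φ x.1 ∈ near n (1 / 16 * (1 / 2) ^ i)}) ?_ ?_ m ?_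
  · intro x hx
    simpa using hS x.1 hx
  · intro i t ht s hs
    have hle : (1 / 16 * (1 / 2) ^ i : ℝ) ≤ 1 / 16 := by
      have : ((1 / 2) ^ i : ℝ) ≤ 1 := pow_le_one₀ (by norm_num) (by norm_num)
      linarith
    have := near_comm hle (hS s.1 hs) ht
    rw [← map_commutatorElement] at this
    have e : (1 / 16 * (1 / 2) ^ (i + 1) : ℝ) = 1 / 16 * (1 / 2) ^ i / 2 := by ring
    show φ (⁅t, s⁆ : Subgroup.closure S).1 ∈ near n (1 / 16 * (1 / 2) ^ (i + 1))
    rw [e]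
    exact this
  · intro t ht
    have hp : (0 : ℝ) < (1 / 2) ^ m := by positivity
    have h5 : φ t.1 ∈ W := hnear (near_mono (by linarith) ht)
    apply Subtype.ext
    apply hinj
    rw [hW1 _ h5]
    simp

/-- complexification -/
noncomputable def iota (n : ℕ) : GL (Fin n) ℝ →* Module.End ℂ (Fin n → ℂ) :=
  ((Matrix.toLinAlgEquiv' (R := ℂ) (n := Fin n)).toAlgHom.toRingHom.toMonoidHom).comp
    ((Complex.ofRealHom.mapMatrix (m := Fin n)).toMonoidHom.comp (Units.coeHom _))

theorem iota_apply (g : GL (Fin n) ℝ) (v : Fin n → ℂ) :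
    iota n g v = ((g : Matrix (Fin n) (Fin n) ℝ).map Complex.ofReal) *ᵥ v := by
  simp [iota]
  rfl

theorem iota_injective : Function.Injective (iota n) := by
  intro g h hgh
  apply Units.ext
  have h1 : Complex.ofRealHom.mapMatrix (g : Matrix (Fin n) (Fin n) ℝ) =
      Complex.ofRealHom.mapMatrix (h : Matrix (Fin n) (Fin n) ℝ) :=
    (Matrix.toLinAlgEquiv' (R := ℂ) (n := Fin n)).injective hgh
  exact Matrix.map_injective Complex.ofReal_injective h1

theorem iota_good {g : GL (Fin n) ℝ} (hg : g ∈ near n (1 / 16)) (μ : ℂ) (hμ : μ.re ≤ 0)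
    (v : Fin n → ℂ) (hv : iota n g v = μ • v) : v = 0 := by
  have h1 : (((g : Matrix (Fin n) (Fin n) ℝ) - 1).map Complex.ofReal) *ᵥ v = (μ - 1) • v := by
    rw [Matrix.map_sub _ (by simp), Matrix.sub_mulVec, ← iota_apply, hv, sub_smul, one_smul]
    simp
  have h2 : ‖((g : Matrix (Fin n) (Fin n) ℝ) - 1).map Complex.ofReal‖ = ‖(g : Matrix (Fin n) (Fin n) ℝ) - 1‖ := by
    generalize (g : Matrix (Fin n) (Fin n) ℝ) - 1 = X
    rw [Matrix.linfty_opNorm_def, Matrix.linfty_opNorm_def]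
    simp
  have h3 := Matrix.linfty_opNorm_mulVec (((g : Matrix (Fin n) (Fin n) ℝ) - 1).map Complex.ofReal) v
  rw [h1, h2, norm_smul] at h3
  have h4 : 1 ≤ ‖μ - 1‖ := by
    have := Complex.abs_re_le_norm (μ - 1)
    have h5 := neg_le_abs (μ - 1).re
    simp only [Complex.sub_re, Complex.one_re] at h5 this
    linarith
  have h6 := hg.1
  have h7 : ‖v‖ = 0 := by
    have := norm_nonneg v
    nlinarith
  exact norm_eq_zero.1 h7

theorem dser_eq_bot {Γ : Type*} [Group Γ] (φ : Γ →* GL (Fin n) ℝ) (hinj : Function.Injective φ)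
    (S : Set Γ) (hS : ∀ s ∈ S, φ s ∈ near n (1 / 16)) (hnil : Group.IsNilpotent (Subgroup.closure S))
    (M : Subgroup Γ)
    (hM : ∀ x ∈ M, iota n (φ x) ∈ Algebra.adjoin ℂ ((fun y => iota n (φ y)) '' (Subgroup.closure S : Set Γ))) :
    dser M n = ⊥ := by
  set B := Algebra.adjoin ℂ ((fun y => iota n (φ y)) '' (Subgroup.closure S : Set Γ)) with hB
  let ψ : Γ →* Module.End ℂ (Fin n → ℂ) := (iota n).comp φ
  let w : Subgroup.closure S →* B := (ψ.comp (Subgroup.closure S).subtype).codRestrict B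
    (fun x => Algebra.subset_adjoin ⟨x.1, x.2, rfl⟩)
  let u : M →* B := (ψ.comp M.subtype).codRestrict B (fun x => hM x.1 x.2)
  have hA : Algebra.adjoin ℂ (Set.range w) = ⊤ := by
    rw [← Algebra.adjoin_adjoin_coe_preimage]
    congr 1
    ext b
    constructor
    · rintro ⟨x, rfl⟩
      exact ⟨x.1, x.2, rfl⟩
    · rintro ⟨x, hx, hxb⟩
      exact ⟨⟨x, hx⟩, Subtype.ext hxb⟩
  have hgood : ∀ s ∈ (Subtype.val : Subgroup.closure S → Γ) ⁻¹' S, ∀ μ : ℂ, μ.re ≤ 0 →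
      ∀ v : Fin n → ℂ, w s • v = μ • v → v = 0 := by
    intro s hs μ hμ v hv
    exact iota_good (hS s.1 hs) μ hμ v hv
  have c0 := core (A := B) (S := (Subtype.val : Subgroup.closure S → Γ) ⁻¹' S)
    Subgroup.closure_closure_coe_preimage w hA u n
  have := c0 (Fin n → ℂ) (by simp) hgood
  rw [← dser_map, eq_bot_iff]
  rintro _ ⟨x, hx, rfl⟩
  have h1 := this hx
  have h2 : iota n (φ x.1) = 1 := LinearMap.ext fun v => h1 v
  have h3 : φ x.1 = 1 := iota_injective (by rw [h2, map_one])
  have h4 : x.1 = 1 := hinj (by rw [h3, map_one])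
  simpa using h4

end analytic

section main

open scoped Topology
open Matrix

variable {n : ℕ} {Γ : Type*} [Group Γ]

/-- The set of discrete and faithful representations -/
def DF (n : ℕ) (Γ : Type*) [Group Γ] : Set (Γ → GL (Fin n) ℝ) :=
  {f | (∀ a b : Γ, f (a * b) = f a * f b) ∧ Function.Injective f ∧ DiscreteTopology (Set.range f)}

theorem eventually_near {f : Γ → GL (Fin n) ℝ} (T : Finset Γ)
    (hT : ∀ t ∈ T, f t ∈ near n (1 / 16)) :
    ∀ᶠ φ in 𝓝[DF n Γ] f, ∀ t ∈ T, φ t ∈ near n (1 / 16) := by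
  rw [Filter.eventually_all_finset]
  intro t ht
  have h1 : Filter.Tendsto (fun φ : Γ → GL (Fin n) ℝ => φ t) (𝓝[DF n Γ] f) (𝓝 (f t)) :=
    ((continuous_apply t).tendsto f).mono_left nhdsWithin_le_nhds
  exact h1.eventually ((near_open _).mem_nhds (hT t ht))

theorem exists_rep {f : Γ → GL (Fin n) ℝ} (hf : f ∈ closure (DF n Γ)) (T : Finset Γ)
    (hT : ∀ t ∈ T, f t ∈ near n (1 / 16)) :
    ∃ φ : Γ →* GL (Fin n) ℝ, Function.Injective φ ∧ DiscreteTopology (Set.range φ) ∧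
      ∀ t ∈ T, φ t ∈ near n (1 / 16) := by
  have : (𝓝[DF n Γ] f).NeBot := mem_closure_iff_nhdsWithin_neBot.1 hf
  obtain ⟨φ, h1, h2⟩ := ((eventually_near T hT).and self_mem_nhdsWithin).exists
  exact ⟨MonoidHom.mk' φ h2.1, h2.2.1, h2.2.2, h1⟩

theorem nilpotent_closure {f : Γ → GL (Fin n) ℝ} (hf : f ∈ closure (DF n Γ)) (T : Finset Γ)
    (hT : ∀ t ∈ T, f t ∈ near n (1 / 16)) : Group.IsNilpotent (Subgroup.closure (T : Set Γ)) := by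
  obtain ⟨φ, h1, h2, h3⟩ := exists_rep hf T hT
  exact zassenhaus φ h1 h2 T h3

theorem limit_mul {f : Γ → GL (Fin n) ℝ} (hf : f ∈ closure (DF n Γ)) (a b : Γ) :
    f (a * b) = f a * f b := by
  have hcl : IsClosed {φ : Γ → GL (Fin n) ℝ | φ (a * b) = φ a * φ b} :=
    isClosed_eq (continuous_apply _) (by fun_prop)
  exact closure_minimal (fun φ hφ => hφ.1 a b) hcl hf

theorem limit_injective
    (hnil : ¬ ∃ N : Subgroup Γ, N.Normal ∧ Group.IsNilpotent N ∧ (N : Set Γ).Infinite)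
    (f : Γ →* GL (Fin n) ℝ) (hf : (f : Γ → GL (Fin n) ℝ) ∈ closure (DF n Γ)) :
    Function.Injective f := by
  have hds : dser f.ker n = ⊥ := by
    rw [eq_bot_iff]
    intro x hx
    obtain ⟨T, hT, hxT⟩ := dser_local _ _ x hx
    have hT' : ∀ t ∈ T, f t ∈ near n (1 / 16) := by
      intro t ht
      have : f t = 1 := hT ht
      rw [this]
      exact one_mem_near (by norm_num)
    obtain ⟨φ, h1, h2, h3⟩ := exists_rep hf T hT'
    have := dser_eq_bot φ h1 (T : Set Γ) h3 (zassenhaus φ h1 h2 T h3)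
      (Subgroup.closure (T : Set Γ)) (fun x hx => Algebra.subset_adjoin ⟨x, hx, rfl⟩)
    rw [this] at hxT
    exact hxT
  have hfin := finite_of_dser hnil n f.ker inferInstance hds
  have : Finite f.ker := hfin
  rw [injective_iff_map_eq_one]
  intro x hx
  obtain ⟨m, hm, hxm⟩ : ∃ m : ℕ, 0 < m ∧ x ^ m = 1 := by
    have := isOfFinOrder_of_finite (⟨x, hx⟩ : f.ker)
    obtain ⟨m, hm, h⟩ := isOfFinOrder_iff_pow_eq_one.1 this
    exact ⟨m, hm, by simpa using congrArg Subtype.val h⟩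
  let D : (Γ → GL (Fin n) ℝ) → ℝ :=
    fun φ => (∑ i ∈ Finset.range m, (φ x : Matrix (Fin n) (Fin n) ℝ) ^ i).det
  have hD : Continuous D := by
    refine Continuous.matrix_det (continuous_finsetSum _ fun i _ => Continuous.pow ?_ i)
    exact Units.continuous_val.comp (continuous_apply x)
  have hD0 : D f ≠ 0 := by
    simp only [D, hx, Units.val_one, one_pow, Finset.sum_const, Finset.card_range]
    rw [← Nat.cast_smul_eq_nsmul ℝ, Matrix.det_smul, Matrix.det_one, mul_one]
    exact pow_ne_zero _ (Nat.cast_ne_zero.2 hm.ne')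
  have hne : (𝓝[DF n Γ] (f : Γ → GL (Fin n) ℝ)).NeBot := mem_closure_iff_nhdsWithin_neBot.1 hf
  have hev : ∀ᶠ φ in 𝓝[DF n Γ] (f : Γ → GL (Fin n) ℝ), D φ ≠ 0 :=
    nhdsWithin_le_nhds (hD.continuousAt.eventually_ne hD0)
  obtain ⟨φ, h1, h2⟩ := (hev.and self_mem_nhdsWithin).exists
  let φ' : Γ →* GL (Fin n) ℝ := MonoidHom.mk' φ h2.1
  have hpow : (φ x : Matrix (Fin n) (Fin n) ℝ) ^ m = 1 := by
    have : φ' x ^ m = 1 := by rw [← map_pow, hxm, map_one]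
    have := congrArg Units.val this
    rw [Units.val_pow_eq_pow_val] at this
    exact this
  have hgeom := geom_sum_mul (φ x : Matrix (Fin n) (Fin n) ℝ) m
  rw [hpow, sub_self] at hgeom
  have hunit : IsUnit (∑ i ∈ Finset.range m, (φ x : Matrix (Fin n) (Fin n) ℝ) ^ i) := by
    rw [Matrix.isUnit_iff_isUnit_det]
    exact isUnit_iff_ne_zero.2 h1
  have hone : (φ x : Matrix (Fin n) (Fin n) ℝ) - 1 = 0 := (hunit.mul_right_eq_zero).1 hgeom
  have hone' : φ' x = 1 := Units.ext (sub_eq_zero.1 hone)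
  exact h2.2.1 (hone'.trans (map_one φ').symm)

theorem limit_discrete
    (hnil : ¬ ∃ N : Subgroup Γ, N.Normal ∧ Group.IsNilpotent N ∧ (N : Set Γ).Infinite)
    (f : Γ →* GL (Fin n) ℝ) (hf : (f : Γ → GL (Fin n) ℝ) ∈ closure (DF n Γ)) :
    DiscreteTopology (Set.range f) := by
  classical
  have hinj := limit_injective hnil f hf
  let ψ : Γ →* Module.End ℂ (Fin n → ℂ) := (iota n).comp f
  let B : ℝ → Subalgebra ℂ (Module.End ℂ (Fin n → ℂ)) :=
    fun ε => Algebra.adjoin ℂ (ψ '' {x | f x ∈ near n ε})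
  have hBmono : ∀ {ε δ : ℝ}, ε ≤ δ → B ε ≤ B δ := fun h =>
    Algebra.adjoin_mono (Set.image_mono fun x hx => near_mono h hx)
  -- minimal algebra
  obtain ⟨ε, ⟨hε0, hε1⟩, hmin⟩ : ∃ ε : ℝ, (0 < ε ∧ ε ≤ 1 / 16) ∧
      ∀ δ, 0 < δ → δ ≤ ε → B δ = B ε := by
    obtain ⟨_, ⟨ε, hε, rfl⟩, hm⟩ := (wellFounded_lt (α := Submodule ℂ (Module.End ℂ (Fin n → ℂ)))).has_min
      ((fun ε => Subalgebra.toSubmodule (B ε)) '' {ε : ℝ | 0 < ε ∧ ε ≤ 1 / 16})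
      ⟨_, 1 / 16, ⟨by norm_num, le_rfl⟩, rfl⟩
    refine ⟨ε, hε, fun δ h0 h1 => ?_⟩
    by_contra hne
    refine hm _ ⟨δ, ⟨h0, h1.trans hε.2⟩, rfl⟩ ?_
    exact lt_of_le_of_ne (hBmono h1) (fun h => hne (Subalgebra.toSubmodule_injective h))
  -- finite generation
  let C : Finset Γ → Subalgebra ℂ (Module.End ℂ (Fin n → ℂ)) :=
    fun T => Algebra.adjoin ℂ ((fun y => iota n (f y)) '' (Subgroup.closure (T : Set Γ) : Set Γ))
  obtain ⟨T, hT, hTmax⟩ : ∃ T : Finset Γ, (∀ t ∈ T, f t ∈ near n ε) ∧ B ε ≤ C T := by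
    obtain ⟨_, ⟨T, hT, rfl⟩, hm⟩ := (wellFounded_gt (α := Submodule ℂ (Module.End ℂ (Fin n → ℂ)))).has_min
      ((fun T => Subalgebra.toSubmodule (C T)) '' {T : Finset Γ | ∀ t ∈ T, f t ∈ near n ε})
      ⟨_, ∅, by simp, rfl⟩
    refine ⟨T, hT, Algebra.adjoin_le ?_⟩
    rintro _ ⟨x, hx, rfl⟩
    have hle : C T ≤ C (insert x T) :=
      Algebra.adjoin_mono (Set.image_mono (Subgroup.closure_mono (by simp)))
    have heq : C T = C (insert x T) := by
      by_contra hne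
      refine hm _ ⟨insert x T, ?_, rfl⟩ ?_
      · intro t ht
        rcases Finset.mem_insert.1 ht with rfl | ht
        · exact hx
        · exact hT t ht
      · exact lt_of_le_of_ne hle (fun h => hne (Subalgebra.toSubmodule_injective h))
    rw [heq]
    exact Algebra.subset_adjoin ⟨x, Subgroup.subset_closure (by simp), rfl⟩
  have hT16 : ∀ t ∈ T, f t ∈ near n (1 / 16) := fun t ht => near_mono hε1 (hT t ht)
  have hconj : ∀ (g : Γ), ∀ b ∈ B ε, ψ g * b * ψ g⁻¹ ∈ B ε := by
    intro g b hb
    have hc : Continuous fun x : GL (Fin n) ℝ => f g * x * (f g)⁻¹ := by fun_prop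
    have hW : (fun x : GL (Fin n) ℝ => f g * x * (f g)⁻¹) ⁻¹' near n ε ∈ 𝓝 1 := by
      refine hc.continuousAt.preimage_mem_nhds ((near_open ε).mem_nhds ?_)
      simpa using one_mem_near hε0
    obtain ⟨δ, hδ, hsub⟩ := exists_near hW
    have hδ' : 0 < min δ ε := lt_min hδ hε0
    rw [← hmin _ hδ' (min_le_right _ _)] at hb
    have hinv : ψ g⁻¹ * ψ g = 1 := by rw [← map_mul]; simp
    have hinv' : ψ g * ψ g⁻¹ = 1 := by rw [← map_mul]; simp
    induction hb using Algebra.adjoin_induction with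
    | mem b hb =>
      obtain ⟨x, hx, rfl⟩ := hb
      rw [← map_mul, ← map_mul]
      refine Algebra.subset_adjoin ⟨_, ?_, rfl⟩
      have := hsub (near_mono (min_le_left _ _) hx)
      simpa using this
    | algebraMap r =>
      rw [← Algebra.commutes, mul_assoc, hinv', mul_one]
      exact Subalgebra.algebraMap_mem _ _
    | add x y _ _ hx hy =>
      rw [mul_add, add_mul]
      exact add_mem hx hy
    | mul x y _ _ hx hy =>
      have : ψ g * (x * y) * ψ g⁻¹ = (ψ g * x * ψ g⁻¹) * (ψ g * y * ψ g⁻¹) := by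
        calc _ = ψ g * x * 1 * y * ψ g⁻¹ := by simp only [mul_assoc, mul_one]
          _ = _ := by rw [← hinv]; simp only [mul_assoc]
      rw [this]
      exact mul_mem hx hy
  let M : Subgroup Γ :=
    { carrier := {x | ψ x ∈ B ε ∧ ψ x⁻¹ ∈ B ε}
      mul_mem' := by
        rintro x y ⟨hx, hx'⟩ ⟨hy, hy'⟩
        refine ⟨?_, ?_⟩
        · rw [map_mul]; exact mul_mem hx hy
        · rw [_root_.mul_inv_rev, map_mul]; exact mul_mem hy' hx'
      one_mem' := by
        refine ⟨?_, ?_⟩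
        · rw [map_one]; exact one_mem _
        · rw [inv_one, map_one]; exact one_mem _
      inv_mem' := by
        rintro x ⟨hx, hx'⟩
        exact ⟨hx', by rw [inv_inv]; exact hx⟩ }
  have hMn : M.Normal := by
    refine ⟨?_⟩
    rintro x ⟨hx, hx'⟩ g
    refine ⟨?_, ?_⟩
    · rw [map_mul, map_mul]; exact hconj g _ hx
    · rw [show (g * x * g⁻¹)⁻¹ = g * x⁻¹ * g⁻¹ by group, map_mul, map_mul]; exact hconj g _ hx'
  have hds : dser M n = ⊥ :=
    dser_eq_bot f hinj (T : Set Γ) hT16 (nilpotent_closure hf T hT16) M (fun x hx => hTmax hx.1)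
  have hMfin := finite_of_dser hnil n M hMn hds
  have hfin : (Set.range f ∩ near n ε).Finite := by
    refine (hMfin.image f).subset ?_
    rintro _ ⟨⟨x, rfl⟩, hx⟩
    refine ⟨x, ⟨Algebra.subset_adjoin ⟨x, hx, rfl⟩, Algebra.subset_adjoin ⟨x⁻¹, ?_, rfl⟩⟩, rfl⟩
    show f x⁻¹ ∈ near n ε
    rw [map_inv]
    exact near_inv hx
  have : DiscreteTopology f.range := by
    refine discreteTopology_of_isOpen_singleton_one ?_
    refine isOpen_singleton_of_finite_mem_nhds (1 : f.range) (s := Subtype.val ⁻¹' near n ε) ?_ ?_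
    · exact continuous_subtype_val.continuousAt.preimage_mem_nhds
        ((near_open ε).mem_nhds (one_mem_near hε0))
    · refine Set.Finite.of_finite_image (f := Subtype.val) (hfin.subset ?_) Subtype.val_injective.injOn
      rintro _ ⟨x, hx, rfl⟩
      exact ⟨x.2, hx⟩
  exact this

end main

end Chuckrow

/-- Chuckrow's theorem: if `Γ` is finitely generated and contains no infinite normal
nilpotent subgroup, then the set of discrete and faithful representations
`Γ → GL(n,ℝ)` is closed in the topology of pointwise convergence. -/
theorem chuckrow (n : ℕ) (Γ : Type*) [Group Γ] (hfg : Group.FG Γ)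
    (hnil : ¬ ∃ N : Subgroup Γ, N.Normal ∧ Group.IsNilpotent N ∧ (N : Set Γ).Infinite) :
    IsClosed {f : Γ → Matrix.GeneralLinearGroup (Fin n) ℝ |
      (∀ a b : Γ, f (a * b) = f a * f b) ∧ Function.Injective f ∧
        DiscreteTopology (Set.range f)} := by
  refine isClosed_of_closure_subset ?_
  intro f hf
  have hmul := Chuckrow.limit_mul hf
  exact ⟨hmul, Chuckrow.limit_injective hnil (MonoidHom.mk' f hmul) hf,
    Chuckrow.limit_discrete hnil (MonoidHom.mk' f hmul) hf⟩
end

section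
/- Let Γ be a finitely generated group that does not contain a nontrivial normal abelian subgroup. Then the set of maps f : Γ → GL(n,ℝ) that are group homomorphisms, are injective, and have discrete image is a closed subset of the space of all maps Γ → GL(n,ℝ) equipped with the topology of pointwise convergence (product topology). -/
open Topology

/-- The commutator estimate. -/
theorem aux_comm_bound {R : Type*} [NormedRing R] (a b : Rˣ) :
    ‖((a * b * a⁻¹ * b⁻¹ : Rˣ) : R) - 1‖ ≤
      2 * ‖(a : R) - 1‖ * ‖(b : R) - 1‖ * (‖((a⁻¹ : Rˣ) : R)‖ * ‖((b⁻¹ : Rˣ) : R)‖) := by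
  have h : ((a * b * a⁻¹ * b⁻¹ : Rˣ) : R) - 1 =
      (((a : R) - 1) * ((b : R) - 1) - ((b : R) - 1) * ((a : R) - 1)) *
        (((a⁻¹ : Rˣ) : R) * ((b⁻¹ : Rˣ) : R)) := by
    have h1 : ((a : R) - 1) * ((b : R) - 1) - ((b : R) - 1) * ((a : R) - 1) =
        (a : R) * b - b * a := by noncomm_ring
    have h2 : (b : R) * a * (((a⁻¹ : Rˣ) : R) * ((b⁻¹ : Rˣ) : R)) = 1 := by
      simp [mul_assoc]
    rw [h1, sub_mul, h2]
    simp [mul_assoc]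
  rw [h]
  have h3 : ‖((a : R) - 1) * ((b : R) - 1) - ((b : R) - 1) * ((a : R) - 1)‖ ≤
      2 * ‖(a : R) - 1‖ * ‖(b : R) - 1‖ := by
    refine (norm_sub_le _ _).trans ?_
    have := norm_mul_le ((a : R) - 1) ((b : R) - 1)
    have := norm_mul_le ((b : R) - 1) ((a : R) - 1)
    nlinarith
  refine (norm_mul_le _ _).trans ?_
  exact mul_le_mul h3 (norm_mul_le _ _) (norm_nonneg _) (by positivity)

/-- Zassenhaus-type lemma: a uniform neighbourhood `U` of `1` such that in a discrete faithful image,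
any set with image in `U` and with a nontrivial element generates a group with a nontrivial center. -/
theorem aux_zassenhaus (R : Type*) [NormedRing R] [CompleteSpace R] :
    ∃ U : Set Rˣ, IsOpen U ∧ (1 : Rˣ) ∈ U ∧
      ∀ (Γ : Type*) [Group Γ] (g : Γ →* Rˣ), Function.Injective g →
        DiscreteTopology (Set.range g) → ∀ S : Set Γ, (∀ s ∈ S, g s ∈ U) → (∃ s ∈ S, s ≠ 1) →
        ∃ z ∈ Subgroup.closure S, z ≠ 1 ∧ ∀ s ∈ S, s * z = z * s := by
  set K : ℝ := ‖(1 : R)‖ + 1 with hK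
  have hK1 : 1 ≤ K := by have := norm_nonneg (1 : R); linarith
  set δ : ℝ := 1 / (4 * K ^ 2) with hδ
  have hδ0 : 0 < δ := by positivity
  have hδ1 : δ ≤ 1 := by
    rw [hδ, div_le_one (by positivity)]; nlinarith
  have hδK : 4 * δ * (K * K) = 1 := by rw [hδ]; field_simp
  have hnb : ∀ a : Rˣ, ‖(a : R) - 1‖ < δ → ‖(a : R)‖ ≤ K := by
    intro a ha
    have := norm_add_le ((a : R) - 1) 1
    rw [sub_add_cancel] at this
    linarith
  have key : ∀ a b : Rˣ, ‖((a⁻¹ : Rˣ) : R)‖ ≤ K → ‖((b⁻¹ : Rˣ) : R)‖ ≤ K → ∀ r : ℝ,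
      ‖(a : R) - 1‖ * ‖(b : R) - 1‖ < δ * r → 
      ‖((a * b * a⁻¹ * b⁻¹ : Rˣ) : R) - 1‖ < r / 2 := by
    intro a b ha hb r hr
    have h1 := aux_comm_bound a b
    have h2 : ‖((a⁻¹ : Rˣ) : R)‖ * ‖((b⁻¹ : Rˣ) : R)‖ ≤ K * K :=
      mul_le_mul ha hb (norm_nonneg _) (by linarith)
    have h3 : 2 * ‖(a : R) - 1‖ * ‖(b : R) - 1‖ * (‖((a⁻¹ : Rˣ) : R)‖ * ‖((b⁻¹ : Rˣ) : R)‖)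
        ≤ 2 * ‖(a : R) - 1‖ * ‖(b : R) - 1‖ * (K * K) :=
      mul_le_mul_of_nonneg_left h2 (by positivity)
    have h4 : 2 * ‖(a : R) - 1‖ * ‖(b : R) - 1‖ * (K * K) < 2 * (δ * r) * (K * K) := by
      have : 0 < K * K := by positivity
      nlinarith
    have h5 : 2 * (δ * r) * (K * K) = r / 2 := by linear_combination (r / 2) * hδK
    linarith
  refine ⟨{a : Rˣ | ‖(a : R) - 1‖ < δ ∧ ‖((a⁻¹ : Rˣ) : R) - 1‖ < δ}, ?_, ?_, ?_⟩
  · refine IsOpen.inter ?_ ?_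
    · exact isOpen_lt ((Units.continuous_val.sub continuous_const).norm) continuous_const
    · exact isOpen_lt (((Units.continuous_val.comp continuous_inv).sub continuous_const).norm)
        continuous_const
  · simp [hδ0]
  · intro Γ _ g hg hd S hS hne
    by_contra hcon
    push Not at hcon
    have step : ∀ k : ℕ, ∃ z ∈ Subgroup.closure S, z ≠ 1 ∧ ‖((g z : Rˣ) : R) - 1‖ < δ / 2 ^ k ∧
        ‖(((g z)⁻¹ : Rˣ) : R) - 1‖ < δ / 2 ^ k := by
      intro k
      induction k with
      | zero =>
        obtain ⟨s, hs, hs1⟩ := hne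
        refine ⟨s, Subgroup.subset_closure hs, hs1, ?_⟩
        simpa using hS s hs
      | succ k ih =>
        obtain ⟨z, hz, hz1, hza, hzb⟩ := ih
        obtain ⟨s, hs, hsz⟩ := hcon z hz hz1
        obtain ⟨hsa, hsb⟩ := hS s hs
        have hle : δ / 2 ^ k ≤ δ := div_le_self hδ0.le (one_le_pow₀ (by norm_num))
        have hzK := hnb _ (lt_of_lt_of_le hzb hle)
        have hsK := hnb _ hsb
        have hpow : δ / 2 ^ (k + 1) = (δ / 2 ^ k) / 2 := by
          rw [pow_succ]; field_simp
        refine ⟨s * z * s⁻¹ * z⁻¹, ?_, ?_, ?_, ?_⟩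
        · have hs' := Subgroup.subset_closure (G := Γ) hs
          exact mul_mem (mul_mem (mul_mem hs' hz) (inv_mem hs')) (inv_mem hz)
        · intro h
          exact hsz (by rwa [mul_inv_eq_one, mul_inv_eq_iff_eq_mul] at h)
        · rw [hpow]
          simp only [map_mul, map_inv]
          refine key (g s) (g z) hsK hzK _ ?_
          exact mul_lt_mul'' hsa hza (norm_nonneg _) (norm_nonneg _)
        · rw [hpow]
          have : (g (s * z * s⁻¹ * z⁻¹))⁻¹ = g z * g s * (g z)⁻¹ * (g s)⁻¹ := by
            simp only [map_mul, map_inv]; group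
          rw [this]
          refine key (g z) (g s) hzK hsK _ ?_
          rw [mul_comm]
          exact mul_lt_mul'' hsa hza (norm_nonneg _) (norm_nonneg _)
    -- discreteness
    have hiso : ∃ W ∈ 𝓝 (1 : Rˣ), ∀ x : Γ, g x ∈ W → g x = 1 := by
      have h1 : IsOpen ({⟨1, 1, map_one g⟩} : Set (Set.range g)) := isOpen_discrete _
      obtain ⟨W, hW, hWe⟩ := isOpen_induced_iff.1 h1
      refine ⟨W, hW.mem_nhds ?_, ?_⟩
      · have : (⟨1, 1, map_one g⟩ : Set.range g) ∈ Subtype.val ⁻¹' W := by rw [hWe]; rfl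
        exact this
      · intro x hx
        have : (⟨g x, x, rfl⟩ : Set.range g) ∈ Subtype.val ⁻¹' W := hx
        rw [hWe] at this
        exact congrArg Subtype.val this
    obtain ⟨W, hW, hWg⟩ := hiso
    rw [Units.isOpenEmbedding_val.isInducing.nhds_eq_comap, Filter.mem_comap] at hW
    obtain ⟨T, hT, hTW⟩ := hW
    obtain ⟨ε, hε, hball⟩ := Metric.mem_nhds_iff.1 hT
    obtain ⟨k, hk⟩ : ∃ k : ℕ, δ / 2 ^ k < ε := by
      obtain ⟨k, hk⟩ := exists_pow_lt_of_lt_one (div_pos hε hδ0) (by norm_num : (1 / 2 : ℝ) < 1)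
      refine ⟨k, ?_⟩
      rw [lt_div_iff₀ hδ0] at hk
      calc δ / 2 ^ k = (1 / 2) ^ k * δ := by rw [one_div, inv_pow]; field_simp
        _ < ε := hk
    obtain ⟨z, -, hz1, hza, -⟩ := step k
    have : g z = 1 := hWg z (hTW (hball (by
      simp only [Metric.mem_ball, dist_eq_norm, Units.val_one]; exact hza.trans hk)))
    exact hz1 (hg (by rw [this, map_one]))

theorem aux_main (R : Type*) [NormedRing R] [NormedAlgebra ℝ R] [FiniteDimensional ℝ R]
    [CompleteSpace R] (Γ : Type*) [Group Γ]
    (hab : ¬ ∃ A : Subgroup Γ, A.Normal ∧ A ≠ ⊥ ∧ ∀ a ∈ A, ∀ b ∈ A, a * b = b * a) :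
    IsClosed {f : Γ → Rˣ |
      (∀ a b : Γ, f (a * b) = f a * f b) ∧ Function.Injective f ∧
        DiscreteTopology (Set.range f)} := by
  set X := {f : Γ → Rˣ |
      (∀ a b : Γ, f (a * b) = f a * f b) ∧ Function.Injective f ∧
        DiscreteTopology (Set.range f)} with hX
  refine isClosed_of_closure_subset ?_
  intro f hf
  have hhom : ∀ a b : Γ, f (a * b) = f a * f b := by
    have hc : IsClosed {f : Γ → Rˣ | ∀ a b : Γ, f (a * b) = f a * f b} := by
      simp only [Set.ofPred_forall]
      refine isClosed_iInter fun a => isClosed_iInter fun b => ?_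
      exact isClosed_eq (continuous_apply _) ((continuous_apply a).mul (continuous_apply b))
    exact closure_minimal (fun f hf => hf.1) hc hf
  let F : Γ →* Rˣ := MonoidHom.mk' f hhom
  have hF : ∀ x, F x = f x := fun _ => rfl
  -- it suffices to find a neighbourhood with trivial preimage
  suffices hW : ∃ W ∈ 𝓝 (1 : Rˣ), ∀ x, F x ∈ W → x = 1 by
    obtain ⟨W, hW, hW1⟩ := hW
    refine ⟨hhom, ?_, ?_⟩
    · refine (injective_iff_map_eq_one F).2 fun x hx => hW1 x ?_
      rw [hx]; exact mem_of_mem_nhds hW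
    · rw [discreteTopology_subtype_iff']
      rintro _ ⟨a, rfl⟩
      obtain ⟨W', hW'W, hW'o, hW'1⟩ := mem_nhds_iff.1 hW
      refine ⟨(fun x => (f a)⁻¹ * x) ⁻¹' W', hW'o.preimage (continuous_const.mul continuous_id), ?_⟩
      ext y
      constructor
      · rintro ⟨hy, b, rfl⟩
        have : a⁻¹ * b = 1 := hW1 _ (hW'W (by
          rw [map_mul, map_inv]; exact hy))
        rw [inv_mul_eq_one] at this
        rw [this]; rfl
      · rintro rfl
        exact ⟨by simpa using hW'1, a, rfl⟩
  by_contra hcon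
  push Not at hcon
  obtain ⟨U, hUo, hU1, hU⟩ := aux_zassenhaus R
  obtain ⟨g₀, hg₀⟩ : X.Nonempty := closure_nonempty_iff.1 ⟨f, hf⟩
  let G : Γ →* Rˣ := MonoidHom.mk' g₀ hg₀.1
  have hGinj : Function.Injective G := hg₀.2.1
  let φ : Γ → R := fun x => ((G x : Rˣ) : R)
  have hφinj : Function.Injective φ := fun x y h => hGinj (Units.ext h)
  have hφmul : ∀ x y, φ (x * y) = φ x * φ y := fun x y => by simp [φ]
  -- linear criterion for commuting
  have hlin : ∀ (c : Γ) (S : Set Γ) (y : Γ), (∀ s ∈ S, s * c = c * s) →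
      φ y ∈ Submodule.span ℝ (φ '' S) → y * c = c * y := by
    intro c S y hS hy
    apply hφinj
    rw [hφmul, hφmul]
    generalize φ y = w at hy ⊢
    induction hy using Submodule.span_induction with
    | mem x hx =>
      obtain ⟨s, hs, rfl⟩ := hx
      rw [← hφmul, ← hφmul, hS s hs]
    | zero => simp
    | add x y _ _ hx hy => rw [add_mul, mul_add, hx, hy]
    | smul r x _ hx => rw [smul_mul_assoc, mul_smul_comm, hx]
  let V : Set Rˣ → Submodule ℝ R := fun W => Submodule.span ℝ (φ '' (F ⁻¹' W))
  have hVmono : ∀ W W', W ⊆ W' → V W ≤ V W' := fun W W' h =>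
    Submodule.span_mono (Set.image_mono (Set.preimage_mono h))
  obtain ⟨W₀, hW₀, hW₀U, hmin⟩ : ∃ W₀ ∈ 𝓝 (1 : Rˣ), W₀ ⊆ U ∧
      ∀ W ∈ 𝓝 (1 : Rˣ), W ⊆ W₀ → V W₀ ≤ V W := by
    obtain ⟨_, ⟨W₀, ⟨h1, h2⟩, rfl⟩, hm⟩ := WellFounded.has_min
      (wellFounded_lt (α := Submodule ℝ R)) (V '' {W | W ∈ 𝓝 (1 : Rˣ) ∧ W ⊆ U})
      ⟨V U, U, ⟨hUo.mem_nhds hU1, subset_rfl⟩, rfl⟩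
    refine ⟨W₀, h1, h2, fun W hW hWW => ?_⟩
    have := hm (V W) ⟨W, ⟨hW, hWW.trans h2⟩, rfl⟩
    by_contra hne
    exact this (lt_of_le_not_ge (hVmono _ _ hWW) hne)
  set P : Set Γ := F ⁻¹' W₀ with hP
  let C : Subgroup Γ := Subgroup.centralizer P
  have hCn : C.Normal := by
    refine ⟨fun c hc γ => ?_⟩
    rw [Subgroup.mem_centralizer_iff] at hc ⊢
    intro p hp
    have hcont : Continuous fun x : Rˣ => (F γ)⁻¹ * x * F γ := by fun_prop
    have hmem : (fun x : Rˣ => (F γ)⁻¹ * x * F γ) ⁻¹' W₀ ∈ 𝓝 (1 : Rˣ) :=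
      hcont.continuousAt.preimage_mem_nhds (by simpa using hW₀)
    have hle := hmin _ (Filter.inter_mem hW₀ hmem) Set.inter_subset_left
    refine hlin _ _ p ?_ (hle (Submodule.subset_span ⟨p, hp, rfl⟩))
    rintro x ⟨-, hx⟩
    have h2 : γ⁻¹ * x * γ ∈ P := by
      change F (γ⁻¹ * x * γ) ∈ W₀
      simpa using hx
    have h3 := hc _ h2
    calc x * (γ * c * γ⁻¹) = γ * ((γ⁻¹ * x * γ) * c) * γ⁻¹ := by group
      _ = γ * (c * (γ⁻¹ * x * γ)) * γ⁻¹ := by rw [h3]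
      _ = γ * c * γ⁻¹ * x := by group
  -- finite set
  obtain ⟨p, hpW, hp1⟩ := hcon W₀ hW₀
  obtain ⟨S, hSP, hSfin, hSspan⟩ : ∃ S ⊆ P, S.Finite ∧ V W₀ ≤ Submodule.span ℝ (φ '' S) := by
    obtain ⟨t, hts, ht⟩ := (Submodule.fg_span_iff_fg_span_finset_subset (R := ℝ) (φ '' P)).1
      (IsNoetherian.noetherian _)
    obtain ⟨S, hSP, hS⟩ := Set.subset_image_iff.1 hts
    refine ⟨S, hSP, ?_, ?_⟩
    · refine Set.Finite.of_finite_image ?_ hφinj.injOn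
      rw [hS]; exact t.finite_toSet
    · rw [hS]; exact ht.le
  let S' : Set Γ := insert p S
  have hS'P : S' ⊆ P := Set.insert_subset hpW hSP
  have hS'fin : S'.Finite := hSfin.insert p
  -- approximate
  obtain ⟨g, hgU, hgX⟩ : ∃ g : Γ → Rˣ, (∀ s ∈ S', g s ∈ U) ∧ g ∈ X := by
    have hopen : IsOpen (S'.pi fun _ => U) := isOpen_set_pi hS'fin fun _ _ => hUo
    obtain ⟨g, h1, h2⟩ := mem_closure_iff.1 hf _ hopen (fun s hs => hW₀U (hS'P hs))
    exact ⟨g, h1, h2⟩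
  obtain ⟨z, hzS, hz1, hzc⟩ := hU Γ (MonoidHom.mk' g hgX.1) hgX.2.1 hgX.2.2 S' hgU
    ⟨p, Set.mem_insert _ _, hp1⟩
  have hzC : z ∈ C := by
    rw [Subgroup.mem_centralizer_iff]
    intro q hq
    exact hlin z S q (fun s hs => hzc s (Set.mem_insert_of_mem _ hs))
      (hSspan (Submodule.subset_span ⟨q, hq, rfl⟩))
  have hzCC : z ∈ Subgroup.centralizer (C : Set Γ) := by
    have : Subgroup.closure S' ≤ Subgroup.centralizer (C : Set Γ) := by
      rw [Subgroup.closure_le]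
      intro s hs
      rw [SetLike.mem_coe, Subgroup.mem_centralizer_iff]
      intro c hc
      exact ((Subgroup.mem_centralizer_iff.1 hc) s (hS'P hs)).symm
    exact this hzS
  refine hab ⟨C ⊓ Subgroup.centralizer (C : Set Γ), inferInstance, ?_, ?_⟩
  · intro h
    have : z ∈ C ⊓ Subgroup.centralizer (C : Set Γ) := ⟨hzC, hzCC⟩
    rw [h, Subgroup.mem_bot] at this
    exact hz1 this
  · rintro a ⟨ha, -⟩ b ⟨-, hb⟩
    exact (Subgroup.mem_centralizer_iff.1 hb) a ha

attribute [local instance] Matrix.linftyOpNormedRing Matrix.linftyOpNormedAlgebra in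
/-- The matrix case, by choosing a norm on matrices. -/
theorem aux_matrix (n : ℕ) (Γ : Type*) [Group Γ]
    (hab : ¬ ∃ A : Subgroup Γ, A.Normal ∧ A ≠ ⊥ ∧ ∀ a ∈ A, ∀ b ∈ A, a * b = b * a) :
    IsClosed {f : Γ → (Matrix (Fin n) (Fin n) ℝ)ˣ |
      (∀ a b : Γ, f (a * b) = f a * f b) ∧ Function.Injective f ∧
        DiscreteTopology (Set.range f)} :=
  haveI : CompleteSpace (Matrix (Fin n) (Fin n) ℝ) := FiniteDimensional.complete ℝ _
  aux_main (Matrix (Fin n) (Fin n) ℝ) Γ hab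

/-- If `Γ` is finitely generated and contains no nontrivial normal abelian subgroup,
then the set of discrete and faithful representations `Γ → GL(n,ℝ)` is closed in the
topology of pointwise convergence. -/
theorem closed_discrete_faithful_of_no_normal_abelian (n : ℕ) (Γ : Type*) [Group Γ]
    (hfg : Group.FG Γ)
    (hab : ¬ ∃ A : Subgroup Γ, A.Normal ∧ A ≠ ⊥ ∧ ∀ a ∈ A, ∀ b ∈ A, a * b = b * a) :
    IsClosed {f : Γ → Matrix.GeneralLinearGroup (Fin n) ℝ |
      (∀ a b : Γ, f (a * b) = f a * f b) ∧ Function.Injective f ∧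
        DiscreteTopology (Set.range f)} := by
  exact aux_matrix n Γ hab
end
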